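/- For all indices i, j ∈ {1,…,n} and all integers k ≥ s ≥ 0, the transition matrix entries satisfy |[Φ(k,s)]_{ij} − 1/n| ≤ (1 − η/(4n²))^{⌈(k−s+1)/B⌉ − 2}. -/

import Mathlib

open scoped BigOperators RealInnerProductSpace
open Filter

/-- A square real matrix is doubly stochastic: nonnegative entries,
all row sums and all column sums equal to 1. -/
def IsDoublyStochastic {n : ℕ} (A : Matrix (Fin n) (Fin n) ℝ) : Prop :=
  (∀ i j, 0 ≤ A i j) ∧ (∀ i, ∑ j, A i j = 1) ∧ (∀ j, ∑ i, A i j = 1)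

/-- Assumption 1 (Weights): each `A k` is doubly stochastic with positive diagonal,
and every positive entry is at least `η`, where `η > 0`. -/
def WeightsAssumption {n : ℕ} (A : ℕ → Matrix (Fin n) (Fin n) ℝ) (η : ℝ) : Prop :=
  0 < η ∧ ∀ k, IsDoublyStochastic (A k) ∧ (∀ i, 0 < A k i i) ∧
    (∀ i j, 0 < A k i j → η ≤ A k i j)

/-- Assumption 2 (Connectivity): `B ≥ 1` and, for every `k`, the directed graph with an
edge from `j` to `i` whenever `[A t]_{i j} > 0` for some `t ∈ [kB, (k+1)B)` is strongly
connected (every vertex reaches every other vertex by a directed path). -/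
def ConnectivityAssumption {n : ℕ} (A : ℕ → Matrix (Fin n) (Fin n) ℝ) (B : ℕ) : Prop :=
  1 ≤ B ∧ ∀ k : ℕ, ∀ i j : Fin n,
    Relation.ReflTransGen
      (fun u v : Fin n => ∃ t : ℕ, k * B ≤ t ∧ t < (k + 1) * B ∧ 0 < A t v u) i j

/-- The transition matrix `Φ(k,s) = A(k) A(k−1) ⋯ A(s+1) A(s)` (for `k ≥ s`). -/
noncomputable def Phi {n : ℕ} (A : ℕ → Matrix (Fin n) (Fin n) ℝ) (k s : ℕ) :
    Matrix (Fin n) (Fin n) ℝ :=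
  ((List.range (k + 1 - s)).map (fun t => A (k - t))).prod

open Finset

/-- `A` has a positive entry joining `S` and its complement, in either direction. -/
def Crosses {n : ℕ} (A : Matrix (Fin n) (Fin n) ℝ) (S : Finset (Fin n)) : Prop :=
  ∃ i ∈ S, ∃ j ∉ S, 0 < A i j ∨ 0 < A j i

/-- The initial segment `{0, …, d}` of `Fin n`. -/
def initialCut (n d : ℕ) : Finset (Fin n) := univ.filter fun i => i.val ≤ d

theorem mem_initialCut {n d : ℕ} {i : Fin n} : i ∈ initialCut n d ↔ i.val ≤ d := by
  simp [initialCut]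

/-- The conditions which the weights assumption imposes on a single matrix. -/
def IsWeightMatrix {n : ℕ} (A : Matrix (Fin n) (Fin n) ℝ) (η : ℝ) : Prop :=
  IsDoublyStochastic A ∧ (∀ i, 0 < A i i) ∧ ∀ i j, 0 < A i j → η ≤ A i j

theorem sum_mul_sq_sub_sq_sum {ι : Type*} [Fintype ι] (a x : ι → ℝ) (ha : ∑ i, a i = 1) :
    ∑ i, a i * x i ^ 2 - (∑ i, a i * x i) ^ 2
      = (1 / 2) * ∑ i, ∑ j, a i * a j * (x i - x j) ^ 2 := by
  have h : ∀ i, ∑ j, a i * a j * (x i - x j) ^ 2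
      = a i * x i ^ 2 - 2 * (a i * x i) * (∑ j, a j * x j) + a i * ∑ j, a j * x j ^ 2 := by
    intro i
    have h1 : a i * x i ^ 2 = a i * x i ^ 2 * ∑ j, a j := by rw [ha, mul_one]
    rw [h1, mul_sum, mul_sum, mul_sum, ← sum_sub_distrib, ← sum_add_distrib]
    exact sum_congr rfl fun j _ => by ring
  simp_rw [h]
  rw [sum_add_distrib, sum_sub_distrib, ← sum_mul, ← sum_mul, ← mul_sum, ha]
  ring

theorem sum_sq_mulVec {n : ℕ} {A : Matrix (Fin n) (Fin n) ℝ} (hA : IsDoublyStochastic A)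
    (x : Fin n → ℝ) :
    ∑ i, x i ^ 2 - ∑ i, (A.mulVec x) i ^ 2
      = ∑ k, (1 / 2) * ∑ i, ∑ j, A k i * A k j * (x i - x j) ^ 2 := by
  have h : ∑ i, x i ^ 2 = ∑ k, ∑ i, A k i * x i ^ 2 := by
    rw [sum_comm]
    exact sum_congr rfl fun i _ => by rw [← sum_mul, hA.2.2, one_mul]
  rw [h, ← sum_sub_distrib]
  exact sum_congr rfl fun k _ => by
    rw [← sum_mul_sq_sub_sq_sum _ _ (hA.2.1 k)]; rfl

theorem sum_sq_mulVec_le {n : ℕ} {A : Matrix (Fin n) (Fin n) ℝ} (hA : IsDoublyStochastic A)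
    (x : Fin n → ℝ) : ∑ i, (A.mulVec x) i ^ 2 ≤ ∑ i, x i ^ 2 := by
  rw [← sub_nonneg, sum_sq_mulVec hA]
  exact sum_nonneg fun k _ => mul_nonneg (by norm_num) <| sum_nonneg fun i _ =>
    sum_nonneg fun j _ => mul_nonneg (mul_nonneg (hA.1 _ _) (hA.1 _ _)) (sq_nonneg _)

theorem sum_mulVec {n : ℕ} {A : Matrix (Fin n) (Fin n) ℝ} (hA : IsDoublyStochastic A)
    (x : Fin n → ℝ) : ∑ i, (A.mulVec x) i = ∑ i, x i := by
  simp only [Matrix.mulVec, dotProduct]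
  rw [sum_comm]
  exact sum_congr rfl fun i _ => by rw [← sum_mul, hA.2.2, one_mul]

/-- A weight matrix whose graph crosses the cut `S` moves mass at least `η / 2` across it. -/
theorem half_le_sum_cut {n : ℕ} {A : Matrix (Fin n) (Fin n) ℝ} {η : ℝ}
    (hA : IsWeightMatrix A η) {S : Finset (Fin n)} (hS : Crosses A S) :
    η / 2 ≤ ∑ k, (∑ i ∈ S, A k i) * ∑ i ∈ Sᶜ, A k i := by
  obtain ⟨⟨h0, hrow, hcol⟩, hdiag, hη⟩ := hA
  have hnn : ∀ (k : Fin n) (T : Finset (Fin n)), 0 ≤ ∑ i ∈ T, A k i :=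
    fun k T => sum_nonneg fun i _ => h0 k i
  have hsplit : ∀ k, ∑ i ∈ S, A k i + ∑ i ∈ Sᶜ, A k i = 1 := fun k => by
    rw [sum_add_sum_compl, hrow]
  have hle : ∀ (k i : Fin n) (T : Finset (Fin n)), i ∈ T → A k i ≤ ∑ i ∈ T, A k i :=
    fun k i T hi => single_le_sum (f := fun i => A k i) (fun j _ => h0 k j) hi
  have hnn' : ∀ k ∈ univ, 0 ≤ (∑ i ∈ S, A k i) * ∑ i ∈ Sᶜ, A k i :=
    fun k _ => mul_nonneg (hnn k S) (hnn k Sᶜ)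
  have hdS : ∀ k ∈ S, η ≤ ∑ i ∈ S, A k i := fun k hk => (hη k k (hdiag k)).trans (hle k k S hk)
  have hflow : ∑ k ∈ S, ∑ i ∈ Sᶜ, A k i = ∑ k ∈ Sᶜ, ∑ i ∈ S, A k i := by
    have h1 : ∑ k ∈ S, (∑ i ∈ S, A k i + ∑ i ∈ Sᶜ, A k i) = ∑ k ∈ S, 1 :=
      sum_congr rfl fun k _ => hsplit k
    have h2 : ∑ i ∈ S, (∑ k ∈ S, A k i + ∑ k ∈ Sᶜ, A k i) = ∑ k ∈ S, 1 :=
      sum_congr rfl fun i _ => by rw [sum_add_sum_compl, hcol]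
    rw [sum_add_distrib] at h1 h2
    rw [sum_comm (s := S) (t := S)] at h2
    have h3 : ∑ k ∈ Sᶜ, ∑ i ∈ S, A k i = ∑ i ∈ S, ∑ k ∈ Sᶜ, A k i := sum_comm
    linarith
  have hflow_ge : η ≤ ∑ k ∈ S, ∑ i ∈ Sᶜ, A k i := by
    obtain ⟨i, hi, j, hj, h | h⟩ := hS
    · exact ((hη _ _ h).trans (hle i j Sᶜ (mem_compl.2 hj))).trans
        (single_le_sum (f := fun k => ∑ i ∈ Sᶜ, A k i) (fun k _ => hnn k Sᶜ) hi)
    · rw [hflow]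
      exact ((hη _ _ h).trans (hle j i S hi)).trans
        (single_le_sum (f := fun k => ∑ i ∈ S, A k i) (fun k _ => hnn k S) (mem_compl.2 hj))
  by_cases hbig : ∃ k ∈ S, ∑ i ∈ S, A k i ≤ 1 / 2
  · obtain ⟨k, hk, hk2⟩ := hbig
    refine le_trans ?_ (single_le_sum hnn' (mem_univ k))
    nlinarith [hsplit k, hdS k hk, hnn k S, hnn k Sᶜ]
  · push Not at hbig
    calc η / 2 ≤ ∑ k ∈ S, (1 / 2) * ∑ i ∈ Sᶜ, A k i := by rw [← mul_sum]; linarith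
      _ ≤ ∑ k ∈ S, (∑ i ∈ S, A k i) * ∑ i ∈ Sᶜ, A k i :=
        sum_le_sum fun k hk => mul_le_mul_of_nonneg_right (hbig k hk).le (hnn k Sᶜ)
      _ ≤ _ := sum_le_sum_of_subset_of_nonneg (subset_univ S) fun k hk _ => hnn' k hk

theorem sum_sq_gaps_le {y : ℕ → ℝ} (hy : Monotone y) (E : Finset ℕ) {u v : ℝ}
    (hE : ∀ d ∈ E, u ≤ y d ∧ y (d + 1) ≤ v) :
    ∑ d ∈ E, (y (d + 1) - y d) ^ 2 ≤ (u - v) ^ 2 := by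
  have hg : ∀ d, 0 ≤ y (d + 1) - y d := fun d => sub_nonneg.2 (hy d.le_succ)
  rcases E.eq_empty_or_nonempty with rfl | hne
  · simpa using sq_nonneg (u - v)
  have hsub : E ⊆ Ico (E.min' hne) (E.max' hne + 1) := fun d hd =>
    mem_Ico.2 ⟨E.min'_le d hd, Nat.lt_succ_of_le (E.le_max' d hd)⟩
  have hsum : ∑ d ∈ E, (y (d + 1) - y d) ≤ v - u := by
    refine (sum_le_sum_of_subset_of_nonneg hsub fun d _ _ => hg d).trans ?_
    rw [sum_Ico_sub y ((E.min'_le_max' hne).trans (Nat.le_succ _))]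
    have h1 := (hE _ (E.min'_mem hne)).1
    have h2 := (hE _ (E.max'_mem hne)).2
    linarith
  calc ∑ d ∈ E, (y (d + 1) - y d) ^ 2 ≤ (∑ d ∈ E, (y (d + 1) - y d)) ^ 2 :=
        sum_sq_le_sq_sum_of_nonneg fun d _ => hg d
    _ ≤ (v - u) ^ 2 := pow_le_pow_left₀ (sum_nonneg fun d _ => hg d) hsum 2
    _ = (u - v) ^ 2 := by ring

/-- One step decreases the sum of squares by `η / 2` times the sum of the squared gaps at the cuts
which are crossed in this step, as long as these cuts still separate the values. -/
theorem sum_sq_gaps_le_decrease {n : ℕ} {A : Matrix (Fin n) (Fin n) ℝ} {η : ℝ}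
    (hA : IsWeightMatrix A η) {y : ℕ → ℝ} (hy : Monotone y) (D : Finset ℕ) (x : Fin n → ℝ)
    (hlo : ∀ d ∈ D, ∀ i : Fin n, i.val ≤ d → x i ≤ y d)
    (hhi : ∀ d ∈ D, ∀ i : Fin n, d < i.val → y (d + 1) ≤ x i)
    (hD : ∀ d ∈ D, Crosses A (initialCut n d)) :
    η / 2 * ∑ d ∈ D, (y (d + 1) - y d) ^ 2 ≤ ∑ i, x i ^ 2 - ∑ i, (A.mulVec x) i ^ 2 := by
  set f : ℕ → Fin n → Fin n → ℝ := fun d i j =>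
    if i.val ≤ d ∧ d < j.val then (y (d + 1) - y d) ^ 2 else 0 with hf
  have hsep : ∀ i j : Fin n, ∑ d ∈ D, f d i j ≤ (x i - x j) ^ 2 := by
    intro i j
    rw [hf, ← sum_filter]
    refine sum_sq_gaps_le hy _ fun d hd => ?_
    rw [mem_filter] at hd
    exact ⟨hlo d hd.1 i hd.2.1, hhi d hd.1 j hd.2.2⟩
  have hzero : ∀ i j : Fin n, j ≤ i → ∑ d ∈ D, f d i j = 0 := fun i j hij =>
    sum_eq_zero fun d _ => if_neg fun h => by
      have : j.val ≤ i.val := hij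
      omega
  have hsep2 : ∀ i j : Fin n, ∑ d ∈ D, f d i j + ∑ d ∈ D, f d j i ≤ (x i - x j) ^ 2 := by
    intro i j
    rcases le_total i j with h | h
    · rw [hzero j i h, add_zero]
      exact hsep i j
    · rw [hzero i j h, zero_add, sub_sq_comm]
      exact hsep j i
  have hcut : ∀ k, ∑ d ∈ D, (y (d + 1) - y d) ^ 2 *
      ((∑ i ∈ initialCut n d, A k i) * ∑ i ∈ (initialCut n d)ᶜ, A k i)
      = ∑ i, ∑ j, A k i * A k j * ∑ d ∈ D, f d i j := by
    intro k
    simp_rw [mul_sum]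
    rw [sum_congr rfl fun i _ => sum_comm (s := (univ : Finset (Fin n))) (t := D), sum_comm]
    refine sum_congr rfl fun d _ => ?_
    simp_rw [← mul_sum, initialCut, compl_filter, sum_filter, sum_mul_sum, mul_sum]
    refine sum_congr rfl fun i _ => sum_congr rfl fun j _ => ?_
    simp only [hf, not_le]
    by_cases h1 : i.val ≤ d <;> by_cases h2 : d < j.val <;> simp [h1, h2]
    ring
  have hrow : ∀ k, ∑ d ∈ D, (y (d + 1) - y d) ^ 2 *
      ((∑ i ∈ initialCut n d, A k i) * ∑ i ∈ (initialCut n d)ᶜ, A k i)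
      ≤ (1 / 2) * ∑ i, ∑ j, A k i * A k j * (x i - x j) ^ 2 := by
    intro k
    have hsymm : ∑ i, ∑ j, A k i * A k j * ∑ d ∈ D, f d i j
        = ∑ i, ∑ j, A k i * A k j * ∑ d ∈ D, f d j i := by
      rw [sum_comm]
      exact sum_congr rfl fun i _ => sum_congr rfl fun j _ => by rw [mul_comm (A k j)]
    have hle : ∑ i, ∑ j, A k i * A k j * (∑ d ∈ D, f d i j + ∑ d ∈ D, f d j i)
        ≤ ∑ i, ∑ j, A k i * A k j * (x i - x j) ^ 2 :=
      sum_le_sum fun i _ => sum_le_sum fun j _ =>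
        mul_le_mul_of_nonneg_left (hsep2 i j) (mul_nonneg (hA.1.1 _ _) (hA.1.1 _ _))
    simp_rw [mul_add, sum_add_distrib] at hle
    rw [hcut]
    linarith
  rw [sum_sq_mulVec hA.1]
  refine le_trans ?_ (sum_le_sum fun k _ => hrow k)
  rw [sum_comm, mul_sum]
  refine sum_le_sum fun d hd => ?_
  rw [← mul_sum, mul_comm]
  exact mul_le_mul_of_nonneg_left (half_le_sum_cut hA (hD d hd)) (sq_nonneg _)

theorem mulVec_le_of_forall_eq_zero {n : ℕ} {A : Matrix (Fin n) (Fin n) ℝ}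
    (hA : IsDoublyStochastic A) {S : Finset (Fin n)} {i : Fin n} (hS : ∀ j ∉ S, A i j = 0)
    {x : Fin n → ℝ} {c : ℝ} (hx : ∀ j ∈ S, x j ≤ c) : (A.mulVec x) i ≤ c := by
  calc (A.mulVec x) i = ∑ j, A i j * x j := rfl
    _ ≤ ∑ j, A i j * c := sum_le_sum fun j _ => by
        by_cases hj : j ∈ S
        · exact mul_le_mul_of_nonneg_left (hx j hj) (hA.1 i j)
        · simp [hS j hj]
    _ = c := by rw [← sum_mul, hA.2.1, one_mul]

theorem eq_zero_of_not_crosses {n : ℕ} {A : Matrix (Fin n) (Fin n) ℝ}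
    (hA : IsDoublyStochastic A) {S : Finset (Fin n)} (hS : ¬ Crosses A S) {i j : Fin n}
    (hi : i ∈ S) (hj : j ∉ S) : A i j = 0 ∧ A j i = 0 := by
  by_contra h
  refine hS ⟨i, hi, j, hj, ?_⟩
  by_contra! h2
  exact h ⟨le_antisymm h2.1 (hA.1 _ _), le_antisymm h2.2 (hA.1 _ _)⟩

theorem bounds_of_not_crosses {n : ℕ} {A : ℕ → Matrix (Fin n) (Fin n) ℝ}
    (hA : ∀ t, IsDoublyStochastic (A t)) {z : ℕ → Fin n → ℝ}
    (hz : ∀ t, z (t + 1) = (A t).mulVec (z t)) {S : Finset (Fin n)} {a b : ℝ}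
    (ha : ∀ i ∈ S, z 0 i ≤ a) (hb : ∀ i ∉ S, b ≤ z 0 i) (T : ℕ)
    (hT : ∀ t < T, ¬ Crosses (A t) S) : (∀ i ∈ S, z T i ≤ a) ∧ ∀ i ∉ S, b ≤ z T i := by
  induction T with
  | zero => exact ⟨ha, hb⟩
  | succ T ih =>
    obtain ⟨h1, h2⟩ := ih fun t ht => hT t (ht.trans T.lt_succ_self)
    have hn := hT T T.lt_succ_self
    rw [hz]
    refine ⟨fun i hi => mulVec_le_of_forall_eq_zero (hA T)
      (fun j hj => (eq_zero_of_not_crosses (hA T) hn hi hj).1) h1, fun i hi => ?_⟩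
    have := mulVec_le_of_forall_eq_zero (hA T) (S := Sᶜ) (i := i) (x := -z T) (c := -b)
      (fun j hj => (eq_zero_of_not_crosses (hA T) hn (by simpa using hj) hi).2)
      (fun j hj => neg_le_neg (h2 j (mem_compl.1 hj)))
    rw [Matrix.mulVec_neg, Pi.neg_apply] at this
    exact neg_le_neg_iff.1 this

/-- Over a window in which every proper cut is crossed, the sum of squares decreases by at least
`η / 2` times the sum of the squared gaps of the sorted initial values. -/
theorem sum_sq_gaps_le_window_decrease {n : ℕ} {A : ℕ → Matrix (Fin n) (Fin n) ℝ} {η : ℝ}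
    (hA : ∀ t, IsWeightMatrix (A t) η) {z : ℕ → Fin n → ℝ}
    (hz : ∀ t, z (t + 1) = (A t).mulVec (z t)) {y : ℕ → ℝ} (hy : Monotone y)
    (hzy : ∀ i, z 0 i = y i.val) (B : ℕ)
    (hB : ∀ d ∈ range (n - 1), ∃ t < B, Crosses (A t) (initialCut n d)) :
    η / 2 * ∑ d ∈ range (n - 1), (y (d + 1) - y d) ^ 2
      ≤ ∑ i, z 0 i ^ 2 - ∑ i, z B i ^ 2 := by
  classical
  have hfirst : ∀ d, ∃ T, d ∈ range (n - 1) → T < B ∧ Crosses (A T) (initialCut n d) ∧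
      ∀ t < T, ¬ Crosses (A t) (initialCut n d) := by
    intro d
    by_cases hd : d ∈ range (n - 1)
    · have hex : ∃ t, Crosses (A t) (initialCut n d) := (hB d hd).imp fun _ h => h.2
      obtain ⟨t, ht, htc⟩ := hB d hd
      exact ⟨Nat.find hex, fun _ => ⟨(Nat.find_min' hex htc).trans_lt ht, Nat.find_spec hex,
        fun s hs => Nat.find_min hex hs⟩⟩
    · exact ⟨0, fun h => absurd h hd⟩
  choose τ hτ using hfirst
  rw [← sum_range_sub' (fun t => ∑ i, z t i ^ 2) B,
    ← sum_fiberwise_of_maps_to (t := range B) (g := τ) fun d hd => mem_range.2 (hτ d hd).1,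
    mul_sum]
  refine sum_le_sum fun t _ => ?_
  have hbd : ∀ d ∈ (range (n - 1)).filter (fun d => τ d = t),
      (∀ i ∈ initialCut n d, z t i ≤ y d) ∧ ∀ i ∉ initialCut n d, y (d + 1) ≤ z t i := by
    intro d hd
    obtain ⟨hd', rfl⟩ := mem_filter.1 hd
    refine bounds_of_not_crosses (fun t => (hA t).1) hz (fun i hi => ?_) (fun i hi => ?_) (τ d)
      (hτ d hd').2.2
    · rw [hzy]
      exact hy (mem_initialCut.1 hi)
    · rw [hzy]
      rw [mem_initialCut, not_le] at hi
      exact hy hi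
  rw [hz t]
  refine sum_sq_gaps_le_decrease (hA t) hy _ (z t)
    (fun d hd i hi => (hbd d hd).1 i (mem_initialCut.2 hi))
    (fun d hd i hi => (hbd d hd).2 i (by rwa [mem_initialCut, not_le])) fun d hd => ?_
  obtain ⟨hd', rfl⟩ := mem_filter.1 hd
  exact (hτ d hd').2.1

theorem sum_sq_le_sum_sq_gaps {n : ℕ} {y : ℕ → ℝ} (hy : Monotone y)
    (h0 : ∑ i : Fin n, y i.val = 0) :
    ∑ i : Fin n, y i.val ^ 2 ≤ (n : ℝ) ^ 2 * ∑ d ∈ range (n - 1), (y (d + 1) - y d) ^ 2 := by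
  rcases Nat.eq_zero_or_pos n with rfl | hn
  · simp
  have hne : (univ : Finset (Fin n)).Nonempty := ⟨⟨0, hn⟩, mem_univ _⟩
  obtain ⟨i, -, hi⟩ := exists_le_of_sum_le hne (f := fun i : Fin n => y i.val) (g := fun _ => 0)
    (by simp [h0])
  obtain ⟨j, -, hj⟩ := exists_le_of_sum_le hne (f := fun _ => 0) (g := fun i : Fin n => y i.val)
    (by simp [h0])
  have hmin : y 0 ≤ 0 := (hy (Nat.zero_le i.val)).trans hi
  have hmax : 0 ≤ y (n - 1) := hj.trans (hy (by omega))
  have hterm : ∀ k ∈ (univ : Finset (Fin n)), y k.val ^ 2 ≤ (y (n - 1) - y 0) ^ 2 := by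
    intro k _
    have h1 : y 0 ≤ y k.val := hy (Nat.zero_le _)
    have h2 : y k.val ≤ y (n - 1) := hy (by omega)
    exact sq_le_sq' (by linarith) (by linarith)
  have hcs : (y (n - 1) - y 0) ^ 2
      ≤ ((n - 1 : ℕ) : ℝ) * ∑ d ∈ range (n - 1), (y (d + 1) - y d) ^ 2 := by
    rw [← sum_range_sub]
    simpa using sq_sum_le_card_mul_sum_sq (s := range (n - 1)) (f := fun d => y (d + 1) - y d)
  have hG : 0 ≤ ∑ d ∈ range (n - 1), (y (d + 1) - y d) ^ 2 := sum_nonneg fun _ _ => sq_nonneg _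
  calc ∑ i : Fin n, y i.val ^ 2 ≤ n * (y (n - 1) - y 0) ^ 2 := by
        simpa using sum_le_card_nsmul _ _ _ hterm
    _ ≤ n * (n * ∑ d ∈ range (n - 1), (y (d + 1) - y d) ^ 2) := by
        refine mul_le_mul_of_nonneg_left (hcs.trans ?_) n.cast_nonneg
        exact mul_le_mul_of_nonneg_right (Nat.cast_le.2 (n.sub_le 1)) hG
    _ = _ := by ring

/-- Contraction over a window, for initial values which are already sorted. -/
theorem window_contraction_of_monotone {n : ℕ} {A : ℕ → Matrix (Fin n) (Fin n) ℝ} {η : ℝ}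
    (hη : 0 < η) (hA : ∀ t, IsWeightMatrix (A t) η) {z : ℕ → Fin n → ℝ}
    (hz : ∀ t, z (t + 1) = (A t).mulVec (z t)) (hmono : Monotone (z 0)) (h0 : ∑ i, z 0 i = 0)
    (B : ℕ) (hB : ∀ S : Finset (Fin n), S.Nonempty → Sᶜ.Nonempty → ∃ t < B, Crosses (A t) S) :
    ∑ i, z B i ^ 2 ≤ (1 - η / (2 * (n : ℝ) ^ 2)) * ∑ i, z 0 i ^ 2 := by
  rcases Nat.eq_zero_or_pos n with rfl | hn
  · simp
  set y : ℕ → ℝ := fun d => z 0 ⟨min d (n - 1), by omega⟩ with hy_def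
  have hy : Monotone y := fun a b hab => hmono (Fin.mk_le_mk.2 (min_le_min_right _ hab))
  have hzy : ∀ i, z 0 i = y i.val := fun i => by
    simp only [hy_def]
    congr 1
    exact Fin.ext (by simp; omega)
  have hdec := sum_sq_gaps_le_window_decrease hA hz hy hzy B fun d hd => by
    have hd := mem_range.1 hd
    refine hB _ ⟨⟨0, hn⟩, mem_initialCut.2 (Nat.zero_le d)⟩ ⟨⟨n - 1, by omega⟩, ?_⟩
    rw [mem_compl, mem_initialCut]
    exact not_le.2 hd
  have hgap := sum_sq_le_sum_sq_gaps (n := n) hy (by simpa [← hzy] using h0)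
  simp_rw [← hzy] at hgap
  have hn' : (0 : ℝ) < (n : ℝ) ^ 2 := by positivity
  have hkey : η / (2 * (n : ℝ) ^ 2) * ∑ i, z 0 i ^ 2
      ≤ η / 2 * ∑ d ∈ range (n - 1), (y (d + 1) - y d) ^ 2 := by
    calc _ ≤ η / (2 * (n : ℝ) ^ 2) *
          ((n : ℝ) ^ 2 * ∑ d ∈ range (n - 1), (y (d + 1) - y d) ^ 2) :=
          mul_le_mul_of_nonneg_left hgap (by positivity)
      _ = _ := by field_simp
  linarith

theorem IsWeightMatrix.submatrix {n : ℕ} {A : Matrix (Fin n) (Fin n) ℝ} {η : ℝ}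
    (hA : IsWeightMatrix A η) (σ : Equiv.Perm (Fin n)) : IsWeightMatrix (A.submatrix σ σ) η := by
  obtain ⟨⟨h0, hr, hc⟩, hd, he⟩ := hA
  refine ⟨⟨fun i j => h0 _ _, fun i => ?_, fun j => ?_⟩, fun i => hd _, fun i j => he _ _⟩
  · exact (Equiv.sum_comp σ fun j => A (σ i) j).trans (hr _)
  · exact (Equiv.sum_comp σ fun i => A i (σ j)).trans (hc _)

/-- Contraction over a window in which every proper cut is crossed. -/
theorem window_contraction {n : ℕ} {A : ℕ → Matrix (Fin n) (Fin n) ℝ} {η : ℝ}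
    (hη : 0 < η) (hA : ∀ t, IsWeightMatrix (A t) η) {z : ℕ → Fin n → ℝ}
    (hz : ∀ t, z (t + 1) = (A t).mulVec (z t)) (h0 : ∑ i, z 0 i = 0)
    (B : ℕ) (hB : ∀ S : Finset (Fin n), S.Nonempty → Sᶜ.Nonempty → ∃ t < B, Crosses (A t) S) :
    ∑ i, z B i ^ 2 ≤ (1 - η / (2 * (n : ℝ) ^ 2)) * ∑ i, z 0 i ^ 2 := by
  set σ := Tuple.sort (z 0)
  have h := window_contraction_of_monotone (z := fun t => z t ∘ σ) hη
    (fun t => (hA t).submatrix σ) (fun t => ?_) (Tuple.monotone_sort (z 0)) ?_ B ?_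
  · simp only [Function.comp_apply] at h
    rwa [Equiv.sum_comp σ fun i => z B i ^ 2, Equiv.sum_comp σ fun i => z 0 i ^ 2] at h
  · funext i
    simp only [Function.comp_apply, hz, Matrix.mulVec, dotProduct, Matrix.submatrix_apply]
    exact (Equiv.sum_comp σ fun j => A t (σ i) j * z t j).symm
  · exact (Equiv.sum_comp σ _).trans h0
  · intro S ⟨a, ha⟩ ⟨b, hb⟩
    obtain ⟨t, ht, i, hi, j, hj, hij⟩ := hB (S.map σ.toEmbedding)
      ⟨σ a, by simpa using ha⟩ ⟨σ b, by simpa using hb⟩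
    refine ⟨t, ht, σ.symm i, ?_, σ.symm j, ?_, by simpa using hij⟩
    · simpa [mem_map_equiv] using hi
    · simpa [mem_map_equiv] using hj

theorem ConnectivityAssumption.exists_crosses {n : ℕ} {A : ℕ → Matrix (Fin n) (Fin n) ℝ} {B : ℕ}
    (h : ConnectivityAssumption A B) (q : ℕ) (S : Finset (Fin n)) (hS : S.Nonempty)
    (hS' : Sᶜ.Nonempty) : ∃ t < B, Crosses (A (q * B + t)) S := by
  obtain ⟨a, ha⟩ := hS
  obtain ⟨b, hb⟩ := hS'
  by_contra! hno
  refine mem_compl.1 hb ?_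
  have hab := h.2 q a b
  clear hb
  induction hab with
  | refl => exact ha
  | @tail u v _ huv ih =>
    obtain ⟨t, h1, h2, ht⟩ := huv
    by_contra hv
    refine hno (t - q * B) (by rw [add_mul, one_mul] at h2; omega) ⟨u, ih, v, hv, Or.inr ?_⟩
    rwa [Nat.add_sub_cancel' h1]

theorem Phi_self {n : ℕ} (A : ℕ → Matrix (Fin n) (Fin n) ℝ) (s : ℕ) : Phi A s s = A s := by
  simp [Phi]

theorem Phi_succ {n : ℕ} (A : ℕ → Matrix (Fin n) (Fin n) ℝ) {k s : ℕ} (h : s ≤ k) :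
    Phi A (k + 1) s = A (k + 1) * Phi A k s := by
  have h1 : k + 1 + 1 - s = (k + 1 - s) + 1 := by omega
  simp [Phi, h1, List.range_succ_eq_map, Function.comp_def]

/-- The deviation from `1 / n` of column `j` of the product of the first `L` matrices from `s`. -/
noncomputable def deviation {n : ℕ} (A : ℕ → Matrix (Fin n) (Fin n) ℝ) (s : ℕ) (j : Fin n) :
    ℕ → Fin n → ℝ
  | 0 => fun i => (if i = j then 1 else 0) - 1 / (n : ℝ)
  | L + 1 => (A (s + L)).mulVec (deviation A s j L)

theorem mulVec_sub_const {n : ℕ} {A : Matrix (Fin n) (Fin n) ℝ} (hA : IsDoublyStochastic A)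
    (x : Fin n → ℝ) (c : ℝ) (i : Fin n) :
    (A.mulVec fun l => x l - c) i = (A.mulVec x) i - c := by
  simp only [Matrix.mulVec, dotProduct, mul_sub]
  rw [sum_sub_distrib, ← sum_mul, hA.2.1, one_mul]

theorem deviation_eq {n : ℕ} {A : ℕ → Matrix (Fin n) (Fin n) ℝ}
    (hA : ∀ t, IsDoublyStochastic (A t)) (s : ℕ) (j : Fin n) (L : ℕ) (i : Fin n) :
    deviation A s j (L + 1) i = Phi A (s + L) s i j - 1 / (n : ℝ) := by
  induction L generalizing i with
  | zero =>
    rw [deviation, deviation, mulVec_sub_const (hA _), add_zero, Phi_self]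
    simp [Matrix.mulVec, dotProduct]
  | succ L ih =>
    rw [deviation, funext ih, mulVec_sub_const (hA _), ← add_assoc,
      Phi_succ A (Nat.le_add_right s L)]
    rfl

theorem sum_deviation {n : ℕ} (hn : 1 ≤ n) {A : ℕ → Matrix (Fin n) (Fin n) ℝ}
    (hA : ∀ t, IsDoublyStochastic (A t)) (s : ℕ) (j : Fin n) (L : ℕ) :
    ∑ i, deviation A s j L i = 0 := by
  induction L with
  | zero =>
    have : (n : ℝ) ≠ 0 := by positivity
    simp [deviation, this]
  | succ L ih => rw [deviation, sum_mulVec (hA _), ih]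

theorem antitone_sum_sq_deviation {n : ℕ} {A : ℕ → Matrix (Fin n) (Fin n) ℝ}
    (hA : ∀ t, IsDoublyStochastic (A t)) (s : ℕ) (j : Fin n) :
    Antitone fun L => ∑ i, deviation A s j L i ^ 2 :=
  antitone_nat_of_succ_le fun _ => sum_sq_mulVec_le (hA _) _

theorem sum_sq_deviation_le_one {n : ℕ} (hn : 1 ≤ n) {A : ℕ → Matrix (Fin n) (Fin n) ℝ}
    (hA : ∀ t, IsDoublyStochastic (A t)) (s : ℕ) (j : Fin n) (L : ℕ) :
    ∑ i, deviation A s j L i ^ 2 ≤ 1 := by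
  refine (antitone_sum_sq_deviation hA s j L.zero_le).trans ?_
  have hn' : (0 : ℝ) < n := by positivity
  have h : ∀ i, deviation A s j 0 i ^ 2
      = (if i = j then 1 - 2 / (n : ℝ) else 0) + 1 / (n : ℝ) ^ 2 := by
    intro i
    rw [deviation]
    by_cases hij : i = j
    · simp only [hij, if_true]
      ring
    · simp only [hij, if_false]
      ring
  simp only [h]
  rw [sum_add_distrib]
  simp only [sum_ite_eq', mem_univ, if_true, sum_const, card_univ, Fintype.card_fin, nsmul_eq_mul]
  have h2 : 1 - 2 / (n : ℝ) + n * (1 / (n : ℝ) ^ 2) = 1 - 1 / n := by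
    field_simp
    ring
  rw [h2]
  have : 0 ≤ 1 / (n : ℝ) := by positivity
  linarith

theorem WeightsAssumption.le_one {n : ℕ} (hn : 1 ≤ n) {A : ℕ → Matrix (Fin n) (Fin n) ℝ} {η : ℝ}
    (hA : WeightsAssumption A η) : η ≤ 1 := by
  obtain ⟨⟨h0, hr, -⟩, hd, he⟩ := hA.2 0
  rw [← hr ⟨0, hn⟩]
  exact (he _ _ (hd ⟨0, hn⟩)).trans
    (single_le_sum (f := fun i => A 0 ⟨0, hn⟩ i) (fun j _ => h0 _ j) (mem_univ _))

theorem sum_sq_deviation_le_pow {n : ℕ} (hn : 1 ≤ n) {A : ℕ → Matrix (Fin n) (Fin n) ℝ} {η : ℝ}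
    {B : ℕ} (hA : WeightsAssumption A η) (hConn : ConnectivityAssumption A B) {s q u : ℕ}
    (hu : s + u = q * B) (j : Fin n) (hc : 0 ≤ 1 - η / (2 * (n : ℝ) ^ 2)) (m : ℕ) :
    ∑ i, deviation A s j (u + m * B) i ^ 2 ≤ (1 - η / (2 * (n : ℝ) ^ 2)) ^ m := by
  have hds : ∀ t, IsDoublyStochastic (A t) := fun t => (hA.2 t).1
  induction m with
  | zero => simpa using sum_sq_deviation_le_one hn hds s j _
  | succ m ih =>
    have hstart : s + (u + m * B) = (q + m) * B := by rw [← add_assoc, hu, add_mul]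
    have h := window_contraction (A := fun t => A ((q + m) * B + t))
      (z := fun t => deviation A s j (u + m * B + t)) hA.1 (fun t => hA.2 _)
      (fun t => by rw [← hstart, add_assoc s]; rfl) (sum_deviation hn hds s j _) B
      (hConn.exists_crosses (q + m))
    rw [add_mul, one_mul, ← add_assoc, pow_succ']
    exact h.trans (mul_le_mul_of_nonneg_left ih hc)

/-- under Assumptions 1 and 2, for all indices `i, j` and all `k ≥ s ≥ 0`,
`|[Φ(k,s)]_{ij} − 1/n| ≤ (1 − η/(4n²))^(⌈(k−s+1)/B⌉ − 2)`. -/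
theorem transition_matrix_entry_bound
    (n : ℕ) (hn : 1 ≤ n) (A : ℕ → Matrix (Fin n) (Fin n) ℝ) (η : ℝ) (B : ℕ)
    (hA : WeightsAssumption A η) (hConn : ConnectivityAssumption A B) :
    ∀ (i j : Fin n) (k s : ℕ), s ≤ k →
      |Phi A k s i j - 1 / (n : ℝ)| ≤
        (1 - η / (4 * (n : ℝ) ^ 2)) ^ (⌈((k : ℝ) - s + 1) / (B : ℝ)⌉ - 2) := by
  intro i j k s hsk
  have hds : ∀ t, IsDoublyStochastic (A t) := fun t => (hA.2 t).1
  have hη := hA.1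
  have hη1 := hA.le_one hn
  have hn1 : (1 : ℝ) ≤ (n : ℝ) ^ 2 := one_le_pow₀ (by exact_mod_cast hn)
  have hε : η / (4 * (n : ℝ) ^ 2) ≤ 1 / 4 := by
    rw [div_le_div_iff₀ (by positivity) (by norm_num)]
    linarith
  have hε0 : 0 ≤ η / (4 * (n : ℝ) ^ 2) := by positivity
  have hdouble : η / (2 * (n : ℝ) ^ 2) = 2 * (η / (4 * (n : ℝ) ^ 2)) := by
    field_simp
    ring
  obtain ⟨L, rfl⟩ := Nat.exists_eq_add_of_le hsk
  rw [← deviation_eq hds]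
  have hsq : deviation A s j (L + 1) i ^ 2 ≤ ∑ i, deviation A s j (L + 1) i ^ 2 :=
    single_le_sum (f := fun i => deviation A s j (L + 1) i ^ 2) (fun _ _ => sq_nonneg _)
      (mem_univ i)
  generalize he : ⌈(((s + L : ℕ) : ℝ) - s + 1) / (B : ℝ)⌉ - 2 = e
  rcases le_total e 0 with h | h
  · have h1 := hsq.trans (sum_sq_deviation_le_one hn hds s j _)
    refine (abs_le_one_iff_mul_self_le_one.2 (by rwa [← sq])).trans ?_
    exact one_le_zpow_of_nonpos₀ (by linarith) (by linarith) h
  · lift e to ℕ using h with m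
    rw [zpow_natCast]
    have hB := hConn.1
    have hB0 : (0 : ℝ) < B := by exact_mod_cast hB
    have hlen : (m + 1) * B < L + 1 := by
      have h1 : ((m : ℤ) + 1) < ⌈(((s + L : ℕ) : ℝ) - s + 1) / (B : ℝ)⌉ := by omega
      rw [Int.lt_ceil, lt_div_iff₀ hB0] at h1
      push_cast at h1
      rw [add_sub_cancel_left] at h1
      exact_mod_cast h1
    obtain ⟨q, hq⟩ : ∃ q, q = (s + (B - 1)) / B := ⟨_, rfl⟩
    have hq1 : s ≤ q * B := by
      have := Nat.lt_div_mul_add (a := s + (B - 1)) hB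
      rw [← hq] at this
      omega
    have hq2 : q * B ≤ s + (B - 1) := hq ▸ Nat.div_mul_le_self _ _
    obtain ⟨u, hu⟩ := Nat.exists_eq_add_of_le hq1
    have hle : u + m * B ≤ L + 1 := by
      rw [add_mul, one_mul] at hlen
      omega
    have hV := sum_sq_deviation_le_pow hn hA hConn hu.symm j (by linarith) m
    refine abs_le_of_sq_le_sq ?_ (pow_nonneg (by linarith) m)
    calc deviation A s j (L + 1) i ^ 2 ≤ ∑ i, deviation A s j (L + 1) i ^ 2 := hsq
      _ ≤ ∑ i, deviation A s j (u + m * B) i ^ 2 := antitone_sum_sq_deviation hds s j hle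
      _ ≤ (1 - η / (2 * (n : ℝ) ^ 2)) ^ m := hV
      _ ≤ ((1 - η / (4 * (n : ℝ) ^ 2)) ^ 2) ^ m := by
        refine pow_le_pow_left₀ (by linarith) ?_ m
        rw [hdouble]
        nlinarith [sq_nonneg (η / (4 * (n : ℝ) ^ 2))]
      _ = _ := by rw [← pow_mul, ← pow_mul, mul_comm 2 m]
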